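/- Let (S,E) and (S',E') be finite simple graphs. The Lie algebras n(S,E) and n(S',E') over k are isomorphic as Lie algebras if and only if the graphs (S,E) and (S',E') are isomorphic. -/

import Mathlib

open ExteriorAlgebra

variable (k : Type*) [Field k]

section Wedge

variable {M : Type*} [AddCommGroup M] [Module k M]

/-- The wedge `v ∧ w` of two vectors, as an element of the second exterior power `⋀[k]^2 M`. -/
def wedge (v w : M) : ⋀[k]^2 M :=
  ⟨ι k v * ι k w, by
    show _ ∈ (LinearMap.range (ι k : M →ₗ[k] ExteriorAlgebra k M)) ^ 2
    rw [pow_two]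
    exact Submodule.mul_mem_mul (LinearMap.mem_range_self _ v) (LinearMap.mem_range_self _ w)⟩

theorem wedge_add_left (v v' w : M) :
    wedge k (v + v') w = wedge k v w + wedge k v' w :=
  Subtype.ext <| by simp [wedge, add_mul]

theorem wedge_add_right (v w w' : M) :
    wedge k v (w + w') = wedge k v w + wedge k v w' :=
  Subtype.ext <| by simp [wedge, mul_add]

theorem wedge_smul_left (t : k) (v w : M) :
    wedge k (t • v) w = t • wedge k v w :=
  Subtype.ext <| by simp [wedge, smul_mul_assoc]

theorem wedge_smul_right (t : k) (v w : M) :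
    wedge k v (t • w) = t • wedge k v w :=
  Subtype.ext <| by simp [wedge, mul_smul_comm]

theorem wedge_self (v : M) : wedge k v v = 0 :=
  Subtype.ext <| ι_sq_zero v

theorem wedge_zero_left (w : M) : wedge k 0 w = 0 :=
  Subtype.ext <| by simp [wedge]

theorem wedge_zero_right (v : M) : wedge k v 0 = 0 :=
  Subtype.ext <| by simp [wedge]

end Wedge

section Graph

variable (S : Type*) [DecidableEq S]

/-- The subspace `W ⊆ ⋀²V` spanned by the wedges `α ∧ β` of distinct non-adjacent vertices,
where `V = S → k` has standard basis indexed by the vertex set `S`. -/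
def graphW (G : SimpleGraph S) : Submodule k (⋀[k]^2 (S → k)) :=
  Submodule.span k
    {x | ∃ α β : S, α ≠ β ∧ ¬ G.Adj α β ∧
      x = wedge k (Pi.single α (1 : k)) (Pi.single β (1 : k))}

/-- The underlying vector space `V ⊕ (⋀²V)/W` of the two-step nilpotent Lie algebra `n(S,E)`
associated with a finite simple graph. -/
abbrev graphLie (G : SimpleGraph S) :=
  (S → k) × ((⋀[k]^2 (S → k)) ⧸ graphW k S G)

variable {S}
variable (G : SimpleGraph S)

instance : LieRing (graphLie k S G) where
  bracket p q := (0, Submodule.Quotient.mk (wedge k p.1 q.1))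
  add_lie p q r := by
    refine Prod.ext (by simp) ?_
    show Submodule.Quotient.mk (wedge k (p.1 + q.1) r.1) = _
    rw [wedge_add_left, Submodule.Quotient.mk_add]
    rfl
  lie_add p q r := by
    refine Prod.ext (by simp) ?_
    show Submodule.Quotient.mk (wedge k p.1 (q.1 + r.1)) = _
    rw [wedge_add_right, Submodule.Quotient.mk_add]
    rfl
  lie_self p := by
    refine Prod.ext rfl ?_
    show Submodule.Quotient.mk (wedge k p.1 p.1) = 0
    rw [wedge_self, Submodule.Quotient.mk_zero]
  leibniz_lie p q r := by
    refine Prod.ext (by simp) ?_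
    show Submodule.Quotient.mk (wedge k p.1 (0 : S → k)) =
      Submodule.Quotient.mk (wedge k (0 : S → k) r.1) +
        Submodule.Quotient.mk (wedge k q.1 (0 : S → k))
    simp [wedge_zero_left, wedge_zero_right]

instance : LieAlgebra k (graphLie k S G) where
  lie_smul t p q := by
    refine Prod.ext (show (0 : S → k) = t • 0 by simp) ?_
    show Submodule.Quotient.mk (wedge k p.1 (t • q.1)) = _
    rw [wedge_smul_right, Submodule.Quotient.mk_smul]
    rfl

theorem graphLie_bracket (p q : graphLie k S G) :
    ⁅p, q⁆ = (0, Submodule.Quotient.mk (wedge k p.1 q.1)) := rfl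

end Graph

section Commute

open Finset

variable {k} {S S' : Type*}

/-- The coordinate form of the relation `v ∧ w ∈ W`: the `2 × 2` minor of `v` and `w` at every
edge of `G` vanishes. -/
def GraphCommute (G : SimpleGraph S) (v w : S → k) : Prop :=
  ∀ ⦃γ δ⦄, G.Adj γ δ → v γ * w δ = v δ * w γ

/-- The vectors commuting with `v`. -/
def graphCentralizer (G : SimpleGraph S) (v : S → k) : Submodule k (S → k) where
  carrier := {w | GraphCommute G v w}
  add_mem' {a b} ha hb γ δ h := by simp only [Pi.add_apply, mul_add, ha h, hb h]
  zero_mem' γ δ _ := by simp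
  smul_mem' t a ha γ δ h := by
    simp only [Pi.smul_apply, smul_eq_mul, mul_left_comm _ t, ha h]

theorem graphCommute_single_single [DecidableEq S] {G : SimpleGraph S} {α β : S}
    (h : ¬ G.Adj α β) : GraphCommute G (Pi.single α (1 : k)) (Pi.single β 1) := by
  intro γ δ hγδ
  have h₁ : ¬ (γ = α ∧ δ = β) := by rintro ⟨rfl, rfl⟩; exact h hγδ
  have h₂ : ¬ (δ = α ∧ γ = β) := by rintro ⟨rfl, rfl⟩; exact h hγδ.symm
  simp only [Pi.single_apply, mul_ite, mul_one, mul_zero]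
  grind

theorem graphCommute_symm {G : SimpleGraph S} {G' : SimpleGraph S'}
    {A : (S → k) ≃ₗ[k] (S' → k)}
    (hA : ∀ v w, GraphCommute G v w ↔ GraphCommute G' (A v) (A w))
    (v w : S' → k) : GraphCommute G' v w ↔ GraphCommute G (A.symm v) (A.symm w) := by
  simpa using (hA (A.symm v) (A.symm w)).symm

variable [Fintype S] [Fintype S']

theorem card_add_finrank_graphCentralizer_le {G : SimpleGraph S} {v : S → k} (T : Finset S)
    (hT : ∀ w, (∀ x ∉ T, w x = 0) → GraphCommute G v w → w = 0) :
    #T + Module.finrank k (graphCentralizer G v) ≤ Fintype.card S := by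
  have hinj : Function.Injective
      (Function.ExtendByZero.linearMap k (Subtype.val : T → S)) :=
    Function.extend_injective Subtype.val_injective _
  have hdisj : Disjoint (LinearMap.range (Function.ExtendByZero.linearMap k
      (Subtype.val : T → S))) (graphCentralizer G v) := by
    rw [Submodule.disjoint_def]
    rintro _ ⟨f, rfl⟩ hw
    refine hT _ (fun x hx ↦ ?_) hw
    exact Function.extend_apply' _ _ _ (by rintro ⟨y, rfl⟩; exact hx y.2)
  simpa [LinearMap.finrank_range_of_inj hinj] using
    Submodule.finrank_add_finrank_le_of_disjoint hdisj

theorem card_le_finrank_graphCentralizer_single [DecidableEq S] (G : SimpleGraph S)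
    [DecidableRel G.Adj] (α : S) :
    Fintype.card S ≤ G.degree α + Module.finrank k (graphCentralizer G (Pi.single α (1 : k))) := by
  let R : (S → k) →ₗ[k] (G.neighborFinset α → k) := LinearMap.funLeft k k Subtype.val
  have hker : LinearMap.ker R ≤ graphCentralizer G (Pi.single α (1 : k)) := by
    intro w hw
    have hw' : ∀ δ, G.Adj α δ → w δ = 0 := fun δ hδ ↦
      congrFun (LinearMap.mem_ker.1 hw) ⟨δ, by simpa using hδ⟩
    intro γ δ h
    by_cases hγ : γ = α
    · subst hγ
      simp [hw' δ h, h.ne']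
    · by_cases hδ : δ = α
      · subst hδ
        simp [hw' γ h.symm, hγ]
      · simp [hγ, hδ]
  have h₁ := R.finrank_range_add_finrank_ker
  have h₂ := Submodule.finrank_mono hker
  have h₃ := Submodule.finrank_le (LinearMap.range R)
  simp only [Module.finrank_fintype_fun_eq_card, Fintype.card_coe,
    SimpleGraph.card_neighborFinset_eq_degree] at h₁ h₃
  omega

theorem exists_equiv_apply_ne_zero [DecidableEq S] (A : (S → k) ≃ₗ[k] (S' → k)) :
    ∃ σ : S ≃ S', ∀ α, A (Pi.single α 1) (σ α) ≠ 0 := by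
  have e : S ≃ S' := Fintype.equivOfCardEq (by simpa using A.finrank_eq)
  let B : (S → k) ≃ₗ[k] (S → k) := A.trans (LinearEquiv.funCongrLeft k k e)
  have hdet : (LinearMap.toMatrix' (B : (S → k) →ₗ[k] (S → k))).det ≠ 0 := by
    rw [LinearMap.det_toMatrix']
    exact (LinearEquiv.isUnit_det' B).ne_zero
  rw [Matrix.det_apply] at hdet
  obtain ⟨π, -, hπ⟩ := exists_ne_zero_of_sum_ne_zero hdet
  refine ⟨π.trans e, fun α h ↦ hπ ?_⟩
  rw [prod_eq_zero (mem_univ α), smul_zero]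
  simpa [LinearMap.toMatrix'_apply, B, LinearMap.funLeft_apply] using h

/-- A set of vertices whose span meets the centralizer of `A α` trivially has at most `deg α`
elements. -/
theorem card_le_degree [DecidableEq S] {G : SimpleGraph S} [DecidableRel G.Adj]
    {G' : SimpleGraph S'} {A : (S → k) ≃ₗ[k] (S' → k)}
    (hA : ∀ v w, GraphCommute G v w ↔ GraphCommute G' (A v) (A w))
    {α : S} (T : Finset S')
    (hT : ∀ w, (∀ x ∉ T, w x = 0) → GraphCommute G' (A (Pi.single α 1)) w → w = 0) :
    #T ≤ G.degree α := by
  have h₁ := card_add_finrank_graphCentralizer_le T hT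
  have h₂ := card_le_finrank_graphCentralizer_single (k := k) G α
  have h₃ : Fintype.card S = Fintype.card S' := by simpa using A.finrank_eq
  have h₄ : (graphCentralizer G (Pi.single α (1 : k))).map (A : (S → k) →ₗ[k] (S' → k)) ≤
      graphCentralizer G' (A (Pi.single α 1)) := by
    rintro _ ⟨w, hw, rfl⟩
    exact (hA _ _).1 hw
  have h₅ := Submodule.finrank_mono h₄
  rw [LinearEquiv.finrank_map_eq] at h₅
  omega

variable [DecidableEq S] {G : SimpleGraph S} {G' : SimpleGraph S'}
  [DecidableRel G.Adj] [DecidableRel G'.Adj]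
  {A : (S → k) ≃ₗ[k] (S' → k)}

theorem degree_le_of_apply_ne_zero
    (hA : ∀ v w, GraphCommute G v w ↔ GraphCommute G' (A v) (A w))
    {α : S} {γ : S'} (h : A (Pi.single α 1) γ ≠ 0) : G'.degree γ ≤ G.degree α := by
  rw [← SimpleGraph.card_neighborFinset_eq_degree]
  refine card_le_degree hA _ fun w hw hc ↦ funext fun β ↦ ?_
  by_cases hβ : G'.Adj γ β
  · have hγ : w γ = 0 := hw γ (by simp)
    simpa [hγ, h] using hc hβ
  · exact hw β (by simpa using hβ)

theorem sum_degree_le (hA : ∀ v w, GraphCommute G v w ↔ GraphCommute G' (A v) (A w)) :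
    ∑ γ, G'.degree γ ≤ ∑ α, G.degree α := by
  obtain ⟨σ, hσ⟩ := exists_equiv_apply_ne_zero A
  rw [← Equiv.sum_comp σ]
  exact sum_le_sum fun α _ ↦ degree_le_of_apply_ne_zero hA (hσ α)

variable [DecidableEq S']

/-- The neighbours of any vertex in the support of `A α` are neighbours of, or equal to, each
vertex of degree `deg α` in this support. -/
theorem adj_or_eq_of_apply_ne_zero
    (hA : ∀ v w, GraphCommute G v w ↔ GraphCommute G' (A v) (A w))
    {α : S} {γ δ η : S'} (hγ : A (Pi.single α 1) γ ≠ 0) (hdeg : G'.degree γ = G.degree α)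
    (hδ : A (Pi.single α 1) δ ≠ 0) (hη : G'.Adj δ η) : G'.Adj γ η ∨ η = γ := by
  by_contra! hcon
  obtain ⟨hadj, hne⟩ := hcon
  have hcard : #(insert η (G'.neighborFinset γ)) ≤ G.degree α := by
    refine card_le_degree hA _ fun w hw hc ↦ ?_
    have hwγ : w γ = 0 := hw γ (by simp [hne.symm])
    have hw' : ∀ β, β ≠ η → w β = 0 := by
      intro β hβη
      by_cases hβ : G'.Adj γ β
      · simpa [hwγ, hγ] using hc hβ
      · exact hw β (by simp [hβη, hβ])
    have hwη : w η = 0 := by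
      simpa [hw' δ hη.ne, hδ] using hc hη
    funext β
    by_cases hβ : β = η
    · rw [hβ, hwη, Pi.zero_apply]
    · exact hw' β hβ
  rw [card_insert_of_notMem (by simpa using hadj), SimpleGraph.card_neighborFinset_eq_degree,
    hdeg] at hcard
  omega

theorem degree_eq_of_equiv (hA : ∀ v w, GraphCommute G v w ↔ GraphCommute G' (A v) (A w))
    {σ : S ≃ S'} (hσ : ∀ α, A (Pi.single α 1) (σ α) ≠ 0) (α : S) :
    G'.degree (σ α) = G.degree α := by
  have hle : ∀ α ∈ univ, G'.degree (σ α) ≤ G.degree α :=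
    fun α _ ↦ degree_le_of_apply_ne_zero hA (hσ α)
  refine (sum_eq_sum_iff_of_le hle).1 (le_antisymm (sum_le_sum hle) ?_) α (mem_univ α)
  rw [Equiv.sum_comp σ (fun γ ↦ G'.degree γ)]
  exact sum_degree_le (A := A.symm) (graphCommute_symm hA)

theorem adj_of_adj_equiv (hA : ∀ v w, GraphCommute G v w ↔ GraphCommute G' (A v) (A w))
    {σ : S ≃ S'} (hσ : ∀ α, A (Pi.single α 1) (σ α) ≠ 0) {α β : S}
    (hadj : G'.Adj (σ α) (σ β)) : G.Adj α β := by
  by_contra hnadj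
  have hαβ : α ≠ β := fun h ↦ hadj.ne (congrArg σ h)
  have hcomm : GraphCommute G' (A (Pi.single α 1)) (A (Pi.single β 1)) :=
    (hA _ _).1 (graphCommute_single_single hnadj)
  have hγ : A (Pi.single α 1) (σ α) ≠ 0 := hσ α
  have hprod : A (Pi.single α 1) (σ β) * A (Pi.single β 1) (σ α) ≠ 0 :=
    hcomm hadj ▸ mul_ne_zero (hσ α) (hσ β)
  have hdα := degree_eq_of_equiv hA hσ α
  have hdβ := degree_eq_of_equiv hA hσ β
  have hdeg : G.degree α = G.degree β := le_antisymm
    (hdα ▸ degree_le_of_apply_ne_zero hA (right_ne_zero_of_mul hprod))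
    (hdβ ▸ degree_le_of_apply_ne_zero hA (left_ne_zero_of_mul hprod))
  have hclique : ∀ x, A (Pi.single x 1) (σ α) ≠ 0 → A (Pi.single x 1) (σ β) ≠ 0 →
      G.degree x = G.degree β → ∀ ε, A (Pi.single x 1) ε ≠ 0 → G'.degree ε = G.degree β →
      ε ≠ σ α → G'.Adj (σ α) ε := by
    intro x hxα hxβ hx ε hε hdε hne
    rcases adj_or_eq_of_apply_ne_zero hA hε (hdε.trans hx.symm) hxα hadj with h | h
    · exact (adj_or_eq_of_apply_ne_zero hA hxα (by omega) hxβ h.symm).resolve_right hne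
    · exact h ▸ hadj
  let u : S → k := A (Pi.single α 1) (σ α) • Pi.single β 1 -
    A (Pi.single β 1) (σ α) • Pi.single α 1
  have hAu : ∀ ε, A u ε = A (Pi.single α 1) (σ α) * A (Pi.single β 1) ε -
      A (Pi.single β 1) (σ α) * A (Pi.single α 1) ε := by
    intro ε
    simp only [u, map_sub, map_smul, Pi.sub_apply, Pi.smul_apply, smul_eq_mul]
  have hsmall : ∀ ε, A u ε ≠ 0 → G'.degree ε < G.degree β := by
    intro ε hε
    have hne : ε ≠ σ α := by
      rintro rfl
      exact hε (by rw [hAu]; ring)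
    have hnadj' : ¬ G'.Adj (σ α) ε := fun h ↦
      hε (by rw [hAu, hcomm h]; ring)
    by_contra! hle
    by_cases haε : A (Pi.single α 1) ε = 0
    · have hbε : A (Pi.single β 1) ε ≠ 0 := fun h ↦ hε (by rw [hAu, haε, h]; ring)
      exact hnadj' (hclique β (right_ne_zero_of_mul hprod) (hσ β) rfl ε hbε
        (le_antisymm (degree_le_of_apply_ne_zero hA hbε) hle) hne)
    · exact hnadj' (hclique α hγ (left_ne_zero_of_mul hprod) hdeg ε haε
        (le_antisymm (hdeg ▸ degree_le_of_apply_ne_zero hA haε) hle) hne)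
  have huβ : u β = A (Pi.single α 1) (σ α) := by simp [u, hαβ.symm]
  have hsum : u β = ∑ ε, A u ε * A.symm (Pi.single ε 1) β := by
    conv_lhs => rw [← A.symm_apply_apply u, pi_eq_sum_univ' (A u)]
    simp [map_sum]
  refine hγ (huβ ▸ hsum.trans (sum_eq_zero fun ε _ ↦ ?_))
  by_contra h
  have h₁ := hsmall ε (left_ne_zero_of_mul h)
  have h₂ := degree_le_of_apply_ne_zero (A := A.symm) (graphCommute_symm hA)
    (right_ne_zero_of_mul h)
  omega

theorem nonempty_iso_of_graphCommute_iff {G : SimpleGraph S} {G' : SimpleGraph S'}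
    {A : (S → k) ≃ₗ[k] (S' → k)}
    (hA : ∀ v w, GraphCommute G v w ↔ GraphCommute G' (A v) (A w)) : Nonempty (G ≃g G') := by
  classical
  obtain ⟨σ, hσ⟩ := exists_equiv_apply_ne_zero A
  refine ⟨⟨σ, fun {α β} ↦ ⟨adj_of_adj_equiv hA hσ, fun h ↦ ?_⟩⟩⟩
  have hsub : (G'.neighborFinset (σ α)).map σ.symm.toEmbedding ⊆ G.neighborFinset α := by
    intro β hβ
    simp only [mem_map, SimpleGraph.mem_neighborFinset, Equiv.coe_toEmbedding] at hβ
    obtain ⟨δ, hδ, rfl⟩ := hβ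
    simpa using adj_of_adj_equiv (β := σ.symm δ) hA hσ (by simpa using hδ)
  have heq := eq_of_subset_of_card_le hsub (by simp [degree_eq_of_equiv hA hσ])
  have hβ : β ∈ (G'.neighborFinset (σ α)).map σ.symm.toEmbedding := by simpa [heq] using h
  simp only [mem_map, SimpleGraph.mem_neighborFinset, Equiv.coe_toEmbedding] at hβ
  obtain ⟨δ, hδ, rfl⟩ := hβ
  simpa using hδ

end Commute

section LieIso

variable {k}

theorem wedge_eq_ιMulti {M : Type*} [AddCommGroup M] [Module k M] (v : Fin 2 → M) :
    wedge k (v 0) (v 1) = exteriorPower.ιMulti k 2 v :=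
  Subtype.ext <| by simp [wedge, ExteriorAlgebra.ιMulti_apply, Matrix.vecTail]

theorem exteriorPower_map_wedge {M N : Type*} [AddCommGroup M] [Module k M] [AddCommGroup N]
    [Module k N] (f : M →ₗ[k] N) (v w : M) :
    exteriorPower.map 2 f (wedge k v w) = wedge k (f v) (f w) := by
  have h := exteriorPower.map_apply_ιMulti f ![v, w]
  rwa [← wedge_eq_ιMulti, ← wedge_eq_ιMulti] at h

variable {S S' : Type*} [DecidableEq S] [DecidableEq S'] {G : SimpleGraph S} {G' : SimpleGraph S'}

theorem graphCommute_of_wedge_mem {v w : S → k} (h : wedge k v w ∈ graphW k S G) :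
    GraphCommute G v w := by
  intro γ δ hγδ
  let F : ⋀[k]^2 (S → k) →ₗ[k] k := exteriorPower.alternatingMapLinearEquiv
    ((Matrix.detRowAlternating (n := Fin 2) (R := k)).compLinearMap
      (LinearMap.funLeft k k ![γ, δ]))
  have hF : ∀ a b, F (wedge k a b) = a γ * b δ - a δ * b γ := by
    intro a b
    have h₁ := wedge_eq_ιMulti (k := k) ![a, b]
    simp only [Matrix.cons_val_zero, Matrix.cons_val_one] at h₁
    rw [h₁, exteriorPower.alternatingMapLinearEquiv_apply_ιMulti]
    change Matrix.det (Matrix.of fun i ↦ LinearMap.funLeft k k ![γ, δ] (![a, b] i)) = _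
    rw [Matrix.det_fin_two]
    simp [LinearMap.funLeft_apply]
  have hW : graphW k S G ≤ LinearMap.ker F := by
    refine Submodule.span_le.2 ?_
    rintro _ ⟨α, β, -, hαβ, rfl⟩
    simpa [hF, sub_eq_zero] using graphCommute_single_single (k := k) hαβ hγδ
  simpa [hF, sub_eq_zero] using hW h

theorem wedge_mem_of_graphCommute [Fintype S] (hk : ringChar k ≠ 2) {v w : S → k}
    (h : GraphCommute G v w) : wedge k v w ∈ graphW k S G := by
  let B : (S → k) →ₗ[k] (S → k) →ₗ[k] ⋀[k]^2 (S → k) := LinearMap.mk₂ k (wedge k)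
    (wedge_add_left k) (wedge_smul_left k) (wedge_add_right k) (wedge_smul_right k)
  have hanti : ∀ a b : S → k, wedge k a b = - wedge k b a := by
    intro a b
    have h₁ := wedge_self k (a + b)
    rw [wedge_add_left, wedge_add_right, wedge_add_right, wedge_self, wedge_self, zero_add,
      add_zero] at h₁
    exact eq_neg_of_add_eq_zero_left h₁
  have hsum : ∀ a b : S → k, wedge k a b =
      ∑ γ, ∑ δ, (a γ * b δ) • wedge k (Pi.single γ 1) (Pi.single δ 1) := by
    intro a b
    change B a b = ∑ γ, ∑ δ, (a γ * b δ) • B (Pi.single γ 1) (Pi.single δ 1)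
    conv_lhs => rw [pi_eq_sum_univ' a, pi_eq_sum_univ' b]
    simp only [map_sum, map_smul, LinearMap.sum_apply, LinearMap.smul_apply, Finset.smul_sum,
      smul_smul]
    rw [Finset.sum_comm]
    simp only [mul_comm (b _)]
  have htwo : (2 : k) • wedge k v w ∈ graphW k S G := by
    have h₂ : (2 : k) • wedge k v w = wedge k v w - wedge k w v := by
      rw [hanti w v, two_smul, sub_neg_eq_add]
    rw [h₂, hsum v w, hsum w v, ← Finset.sum_sub_distrib]
    simp only [← Finset.sum_sub_distrib]
    refine Submodule.sum_mem _ fun γ _ ↦ Submodule.sum_mem _ fun δ _ ↦ ?_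
    by_cases hγδ : G.Adj γ δ
    · rw [h hγδ, mul_comm (w γ), sub_self]
      exact Submodule.zero_mem _
    by_cases hne : γ = δ
    · rw [hne, wedge_self, smul_zero, smul_zero, sub_zero]
      exact Submodule.zero_mem _
    · have hmem : wedge k (Pi.single γ 1) (Pi.single δ 1) ∈ graphW k S G :=
        Submodule.subset_span ⟨γ, δ, hne, hγδ, rfl⟩
      exact Submodule.sub_mem _ (Submodule.smul_mem _ _ hmem) (Submodule.smul_mem _ _ hmem)
  exact (Submodule.smul_mem_iff _ (Ring.two_ne_zero hk)).1 htwo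

theorem bracket_eq_zero_iff_graphCommute [Fintype S] (hk : ringChar k ≠ 2)
    (p q : graphLie k S G) : ⁅p, q⁆ = 0 ↔ GraphCommute G p.1 q.1 := by
  rw [graphLie_bracket, Prod.mk_eq_zero, Submodule.Quotient.mk_eq_zero]
  exact ⟨fun h ↦ graphCommute_of_wedge_mem h.2, fun h ↦ ⟨rfl, wedge_mem_of_graphCommute hk h⟩⟩

/-- A Lie algebra isomorphism maps `(⋀²V)/W`, which is the derived algebra, to itself. -/
theorem lieEquiv_apply_inr_fst (f : graphLie k S G ≃ₗ⁅k⁆ graphLie k S' G')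
    (x : (⋀[k]^2 (S → k)) ⧸ graphW k S G) : (f (0, x)).1 = 0 := by
  let F : (⋀[k]^2 (S → k)) ⧸ graphW k S G →ₗ[k] (S' → k) :=
    LinearMap.fst k _ _ ∘ₗ (f : graphLie k S G →ₗ[k] graphLie k S' G') ∘ₗ LinearMap.inr k _ _
  suffices h : F = 0 from LinearMap.congr_fun h x
  refine Submodule.linearMap_qext _ (exteriorPower.linearMap_ext (AlternatingMap.ext fun v ↦ ?_))
  change F (Submodule.Quotient.mk (exteriorPower.ιMulti k 2 v)) = 0
  rw [← wedge_eq_ιMulti]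
  change (f ⁅((v 0, 0) : graphLie k S G), ((v 1, 0) : graphLie k S G)⁆).1 = 0
  rw [LieEquiv.map_lie]
  rfl

theorem lieEquiv_fst_eq_of_fst_eq (f : graphLie k S G ≃ₗ⁅k⁆ graphLie k S' G')
    (p : graphLie k S G) : (f (p.1, 0)).1 = (f p).1 := by
  have h : p = (p.1, 0) + ((0, p.2) : graphLie k S G) := by simp
  conv_rhs => rw [h, map_add, Prod.fst_add, lieEquiv_apply_inr_fst, add_zero]

/-- The linear isomorphism `V ≃ V'` induced on abelianizations. -/
def lieEquivFst (f : graphLie k S G ≃ₗ⁅k⁆ graphLie k S' G') : (S → k) ≃ₗ[k] (S' → k) where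
  toFun v := (f (v, 0)).1
  invFun v := (f.symm (v, 0)).1
  map_add' v w := by
    rw [← Prod.fst_add, ← map_add, Prod.mk_add_mk, add_zero]
  map_smul' t v := by
    rw [RingHom.id_apply, ← Prod.smul_fst, ← map_smul, Prod.smul_mk, smul_zero]
  left_inv v := by
    change (f.symm ((f (v, 0)).1, 0)).1 = v
    rw [lieEquiv_fst_eq_of_fst_eq, LieEquiv.symm_apply_apply]
  right_inv v := by
    change (f ((f.symm (v, 0)).1, 0)).1 = v
    rw [lieEquiv_fst_eq_of_fst_eq, LieEquiv.apply_symm_apply]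

theorem nonempty_iso_of_lieEquiv [Fintype S] [Fintype S'] (hk : ringChar k ≠ 2)
    (f : graphLie k S G ≃ₗ⁅k⁆ graphLie k S' G') : Nonempty (G ≃g G') := by
  refine nonempty_iso_of_graphCommute_iff (A := lieEquivFst f) fun v w ↦ ?_
  rw [← bracket_eq_zero_iff_graphCommute hk ((v, 0) : graphLie k S G) (w, 0),
    ← map_eq_zero_iff f f.injective, LieEquiv.map_lie, bracket_eq_zero_iff_graphCommute hk]
  rfl

theorem map_graphW (σ : G ≃g G') :
    (graphW k S G).map (exteriorPower.map 2 (LinearMap.funLeft k k σ.symm)) = graphW k S' G' := by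
  have hsingle : ∀ α : S, LinearMap.funLeft k k σ.symm (Pi.single α (1 : k)) =
      Pi.single (σ α) 1 := by
    intro α
    ext γ
    simp [LinearMap.funLeft_apply, Pi.single_apply, RelIso.symm_apply_eq]
  rw [graphW, Submodule.map_span, graphW]
  congr 1
  ext x
  constructor
  · rintro ⟨_, ⟨α, β, hne, hadj, rfl⟩, rfl⟩
    exact ⟨σ α, σ β, by simpa using hne, by rwa [σ.map_adj_iff],
      by rw [exteriorPower_map_wedge, hsingle, hsingle]⟩
  · rintro ⟨α, β, hne, hadj, rfl⟩
    refine ⟨_, ⟨σ.symm α, σ.symm β, by simpa using hne, by rwa [σ.symm.map_adj_iff], rfl⟩, ?_⟩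
    rw [exteriorPower_map_wedge, hsingle, hsingle, RelIso.apply_symm_apply,
      RelIso.apply_symm_apply]

/-- The isomorphism of exterior squares induced by a bijection of the vertex sets. -/
noncomputable def exteriorSquareEquiv (σ : S ≃ S') : ⋀[k]^2 (S → k) ≃ₗ[k] ⋀[k]^2 (S' → k) :=
  LinearEquiv.ofLinearMap (exteriorPower.map 2 (LinearMap.funLeft k k σ.symm))
    (exteriorPower.map 2 (LinearMap.funLeft k k σ))
    (by rw [← exteriorPower.map_comp, ← exteriorPower.map_id]; congr 1; ext; simp)
    (by rw [← exteriorPower.map_comp, ← exteriorPower.map_id]; congr 1; ext; simp)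

/-- The Lie algebra isomorphism induced by an isomorphism of graphs. -/
noncomputable def lieEquivOfIso (σ : G ≃g G') : graphLie k S G ≃ₗ⁅k⁆ graphLie k S' G' :=
  let e : graphLie k S G ≃ₗ[k] graphLie k S' G' :=
    (LinearEquiv.funCongrLeft k k σ.symm.toEquiv).prodCongr
      (Submodule.Quotient.equiv _ _ (exteriorSquareEquiv σ.toEquiv) (map_graphW σ))
  { e with
    map_lie' := by
      intro p q
      refine Prod.ext (map_zero (LinearMap.funLeft k k σ.symm)) ?_
      exact congrArg Submodule.Quotient.mk
        (exteriorPower_map_wedge (LinearMap.funLeft k k σ.symm) p.1 q.1) }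

end LieIso

/-- The Lie algebras `n(S,E)` and `n(S',E')` over `k` are isomorphic as Lie
algebras if and only if the graphs `(S,E)` and `(S',E')` are isomorphic. -/
theorem lie_iso_iff_graph_iso
    (hk : ringChar k ≠ 2)
    (S S' : Type*) [Fintype S] [DecidableEq S] [Fintype S'] [DecidableEq S']
    (G : SimpleGraph S) (G' : SimpleGraph S') :
    Nonempty (graphLie k S G ≃ₗ⁅k⁆ graphLie k S' G') ↔ Nonempty (G ≃g G') :=
  ⟨fun ⟨f⟩ ↦ nonempty_iso_of_lieEquiv hk f, fun ⟨σ⟩ ↦ ⟨lieEquivOfIso σ⟩⟩
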